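/- Let J be a hermitian symmetry and G ≤ G̃ two bounded selfadjoint positive definite operators (form inequality). If the open interval (λ⁻, λ⁺) with λ⁻ < 0 < λ⁺ is contained in ρ(JG), then (λ⁻, λ⁺) ⊂ ρ(JG̃). (Monotonicity of the central spectral gap.) -/

import Mathlib

open scoped InnerProductSpace

section Aux
variable {E : Type*} [NormedAddCommGroup E] [InnerProductSpace ℂ E] [CompleteSpace E]

lemma aux_unit (J K : E →L[ℂ] E) (hJinv : J * J = 1) (z : ℂ) :
    z ∉ spectrum ℂ (J * K) ↔ IsUnit (K - z • J) := by
  rw [spectrum.notMem_iff]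
  have hJ : IsUnit (-J) := ⟨⟨-J, -J, by simp [hJinv], by simp [hJinv]⟩, rfl⟩
  have h : algebraMap ℂ (E →L[ℂ] E) z - J * K = (-J) * (K - z • J) := by
    rw [mul_sub, mul_smul_comm, neg_mul, neg_mul, hJinv, Algebra.algebraMap_eq_smul_one]
    module
  rw [h]
  obtain ⟨u, hu⟩ := hJ
  rw [← hu, Units.isUnit_units_mul]

lemma aux_form (J K : E →L[ℂ] E) (x : ℝ) (ψ : E) :
    (⟪(K - (x : ℂ) • J) ψ, ψ⟫_ℂ).re = (⟪K ψ, ψ⟫_ℂ).re - x * (⟪J ψ, ψ⟫_ℂ).re := by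
  simp [inner_sub_left, inner_smul_left]

lemma aux_coer (A : E →L[ℂ] E) (hA : IsSelfAdjoint A) (hu : IsUnit A)
    (h : ∀ ψ : E, 0 ≤ (⟪A ψ, ψ⟫_ℂ).re) :
    ∃ r : ℝ, 0 < r ∧ ∀ ψ : E, r * ‖ψ‖ ^ 2 ≤ (⟪A ψ, ψ⟫_ℂ).re := by
  rcases subsingleton_or_nontrivial E with hE | hE
  · exact ⟨1, one_pos, fun ψ => by simp [Subsingleton.elim ψ 0]⟩
  have h0 : 0 ≤ A := by
    rw [ContinuousLinearMap.nonneg_iff_isPositive, ContinuousLinearMap.isPositive_def']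
    exact ⟨hA, fun ψ => h ψ⟩
  have hs : IsStrictlyPositive A := hu.isStrictlyPositive h0
  obtain ⟨r, hr, hle⟩ := (CFC.exists_pos_algebraMap_le_iff (a := A) hA).2
    fun x hx => hs.spectrum_pos hx
  refine ⟨r, hr, fun ψ => ?_⟩
  rw [ContinuousLinearMap.le_def] at hle
  have := hle.re_inner_nonneg_left ψ
  have e : (algebraMap ℝ (E →L[ℂ] E) r) ψ = (r : ℂ) • ψ := by
    simp [Algebra.algebraMap_eq_smul_one]
  rw [ContinuousLinearMap.sub_apply, e, inner_sub_left, inner_smul_left,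
    inner_self_eq_norm_sq_to_K] at this
  have e2 : ((r : ℂ) * (‖ψ‖ : ℂ) ^ 2).re = r * ‖ψ‖ ^ 2 := by norm_cast
  simp only [Complex.conj_ofReal, map_sub] at this
  have e3 : RCLike.re ((r : ℂ) * (‖ψ‖ : ℂ) ^ 2) = r * ‖ψ‖ ^ 2 := e2
  erw [e3] at this
  exact sub_nonneg.1 this

lemma aux_sa (J G : E →L[ℂ] E) (hJ : IsSelfAdjoint J) (hG : IsSelfAdjoint G) (x : ℝ) :
    IsSelfAdjoint (G - (x : ℂ) • J) := by
  refine hG.sub ?_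
  rw [IsSelfAdjoint, star_smul, hJ.star_eq]
  simp

lemma aux_gap (J G : E →L[ℂ] E) (hJ : IsSelfAdjoint J) (hG : IsSelfAdjoint G)
    (hpos : ∀ ψ : E, 0 ≤ (⟪G ψ, ψ⟫_ℂ).re) (x : ℝ)
    (hu : ∀ t ∈ Set.Icc (0 : ℝ) 1, IsUnit (G - ((t * x : ℝ) : ℂ) • J)) :
    ∀ t ∈ Set.Icc (0 : ℝ) 1, ∀ ψ : E, 0 ≤ (⟪G ψ, ψ⟫_ℂ).re - (t * x) * (⟪J ψ, ψ⟫_ℂ).re := by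
  set S : Set ℝ := {t | ∀ ψ : E, 0 ≤ (⟪G ψ, ψ⟫_ℂ).re - (t * x) * (⟪J ψ, ψ⟫_ℂ).re} with hS
  have hcl : IsClosed S := by
    rw [hS, Set.setOf_forall]
    exact isClosed_iInter fun ψ => isClosed_le (by fun_prop) (by fun_prop)
  refine IsClosed.Icc_subset_of_forall_mem_nhdsWithin (s := S) (hcl.inter isClosed_Icc) ?_ ?_
  · intro ψ
    simpa using hpos ψ
  · rintro s ⟨hs, hs01⟩
    obtain ⟨r, hr, hc⟩ := aux_coer _ (aux_sa J G hJ hG (s * x))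
      (hu s ⟨hs01.1, hs01.2.le⟩) (fun ψ => by rw [aux_form]; exact hs ψ)
    apply mem_nhdsWithin_of_mem_nhds
    have hcont : Filter.Tendsto (fun t : ℝ => |(t - s) * x| * ‖J‖) (nhds s) (nhds 0) := by
      have : Continuous (fun t : ℝ => |(t - s) * x| * ‖J‖) := by fun_prop
      simpa using this.tendsto s
    filter_upwards [hcont.eventually (gt_mem_nhds hr)] with t ht ψ
    have h1 := hc ψ
    rw [aux_form] at h1
    have h2 : |(⟪J ψ, ψ⟫_ℂ).re| ≤ ‖J‖ * ‖ψ‖ ^ 2 :=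
      (Complex.abs_re_le_norm _).trans <| (norm_inner_le_norm _ _).trans <| by
        nlinarith [J.le_opNorm ψ, norm_nonneg ψ]
    have h3 : (t - s) * x * (⟪J ψ, ψ⟫_ℂ).re ≤ r * ‖ψ‖ ^ 2 := by
      calc _ ≤ |(t - s) * x * (⟪J ψ, ψ⟫_ℂ).re| := le_abs_self _
        _ = |(t - s) * x| * |(⟪J ψ, ψ⟫_ℂ).re| := abs_mul _ _
        _ ≤ |(t - s) * x| * (‖J‖ * ‖ψ‖ ^ 2) := by gcongr
        _ = (|(t - s) * x| * ‖J‖) * ‖ψ‖ ^ 2 := by ring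
        _ ≤ r * ‖ψ‖ ^ 2 := by gcongr
    linarith

end Aux


/-- monotonicity of the central spectral gap: if `G ≤ G̃` (form inequality),
both positive definite, and `(λ⁻, λ⁺) ∋ 0` is a gap of `JG`, then it is a gap of `JG̃`. -/
theorem stmt_7 {E : Type*} [NormedAddCommGroup E] [InnerProductSpace ℂ E] [CompleteSpace E]
    (J G Gt : E →L[ℂ] E)
    (hJsa : IsSelfAdjoint J) (hJinv : J * J = 1)
    (hGsa : IsSelfAdjoint G) (hGtsa : IsSelfAdjoint Gt) (γ : ℝ) (hγ : 0 < γ)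
    (hGpos : ∀ ψ : E, γ * ‖ψ‖ ^ 2 ≤ (⟪G ψ, ψ⟫_ℂ).re)
    (hle : ∀ ψ : E, (⟪G ψ, ψ⟫_ℂ).re ≤ (⟪Gt ψ, ψ⟫_ℂ).re)
    (lm lp : ℝ) (hlm : lm < 0) (hlp : 0 < lp)
    (hgap : ∀ x : ℝ, lm < x → x < lp → (x : ℂ) ∉ spectrum ℂ (J * G)) :
    ∀ x : ℝ, lm < x → x < lp → (x : ℂ) ∉ spectrum ℂ (J * Gt) := by
  intro x hx1 hx2
  have hu : ∀ t ∈ Set.Icc (0 : ℝ) 1, IsUnit (G - ((t * x : ℝ) : ℂ) • J) := by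
    rintro t ⟨h0, h1⟩
    refine (aux_unit J G hJinv _).1 (hgap _ ?_ ?_)
    · rcases le_total 0 x with h | h <;> nlinarith
    · rcases le_total 0 x with h | h <;> nlinarith
  have hp := aux_gap J G hJsa hGsa (fun ψ => le_trans (by positivity) (hGpos ψ)) x hu 1 (by simp)
  have hu1 := hu 1 (by simp)
  rw [one_mul] at hp hu1
  obtain ⟨r, hr, hc⟩ := aux_coer _ (aux_sa J G hJsa hGsa x) hu1
    (fun ψ => by rw [aux_form]; exact hp ψ)
  rw [aux_unit J Gt hJinv]
  refine ContinuousLinearMap.isUnit_of_forall_le_norm_inner_map _ (c := ⟨r, hr.le⟩) hr ?_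
  intro ψ
  refine le_trans ?_ (Complex.re_le_norm _)
  have h1 := hc ψ
  rw [aux_form] at h1 ⊢
  have h2 := hle ψ
  change ‖ψ‖ ^ 2 * r ≤ _
  linarith
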